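/- arXiv:2112.11006 — 8 statements merged into one kernel-verified Lean document; each statement's English description precedes it below -/
import Mathlib

section
/- Let T > 0, p > 1 and K > 0, and let f, g : [0,T] × ℝ × ℝ → ℝ satisfy the Khasminskii-type condition a·f(t,a,b) + (p−1)·g(t,a,b)² ≤ K(1 + a² + b²) for all t ∈ [0,T] and all a, b ∈ ℝ. Then for every r ≥ 1, all t ∈ [0,T] and all x, y ∈ ℝ, the truncated coefficients satisfy x·f(t,π_r(x),π_r(y)) + (p−1)·g(t,π_r(x),π_r(y))² ≤ 3K(1 + x² + y²). -/
/-- Truncation map `π_r(x) = min(|x|, r) · sign(x)`. -/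
noncomputable def truncMap (r x : ℝ) : ℝ := min |x| r * Real.sign x

theorem abs_truncMap {r : ℝ} (hr : 0 ≤ r) (x : ℝ) : |truncMap r x| = min |x| r := by
  rcases eq_or_ne x 0 with rfl | hx
  · simp [truncMap, hr]
  · have hs : |Real.sign x| = 1 := by
      rcases Real.sign_apply_eq_of_ne_zero x hx with h | h <;> simp [h]
    rw [truncMap, abs_mul, hs, mul_one, abs_of_nonneg (le_min (abs_nonneg x) hr)]

theorem truncMap_of_abs_le {r x : ℝ} (h : |x| ≤ r) : truncMap r x = x := by
  rw [truncMap, min_eq_left h, mul_comm]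
  rcases lt_trichotomy x 0 with hx | rfl | hx
  · rw [Real.sign_of_neg hx, abs_of_neg hx]; ring
  · simp
  · rw [Real.sign_of_pos hx, abs_of_pos hx, one_mul]

theorem abs_mul_truncMap_of_le_abs {r x : ℝ} (h : r ≤ |x|) : |x| * truncMap r x = r * x := by
  rw [truncMap, min_eq_right h]
  rcases lt_trichotomy x 0 with hx | rfl | hx
  · rw [Real.sign_of_neg hx, abs_of_neg hx]; ring
  · simp
  · rw [Real.sign_of_pos hx, abs_of_pos hx]; ring

/-- A point is a multiple, by a factor `c ≥ 1`, of its truncation, and the factor is absorbed by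
quadratic growth at the cost of the constant `3`. -/
theorem exists_eq_mul_truncMap {r : ℝ} (hr : 1 ≤ r) (x y : ℝ) :
    ∃ c : ℝ, 1 ≤ c ∧ x = c * truncMap r x ∧
      c * (1 + truncMap r x ^ 2 + truncMap r y ^ 2) ≤ 3 * (1 + x ^ 2 + y ^ 2) := by
  have hr0 : 0 < r := by linarith
  have hb := abs_truncMap hr0.le y
  have hby : |truncMap r y| ≤ |y| := hb ▸ min_le_left _ _
  have hbr : |truncMap r y| ≤ r := hb ▸ min_le_right _ _
  have hb2 : truncMap r y ^ 2 ≤ y ^ 2 := sq_le_sq.mpr hby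
  rcases le_total |x| r with h | h
  · refine ⟨1, le_rfl, ?_, ?_⟩
    · rw [truncMap_of_abs_le h, one_mul]
    · rw [truncMap_of_abs_le h]
      nlinarith [sq_nonneg x, sq_nonneg y]
  · have ha2 : truncMap r x ^ 2 = r ^ 2 := by
      rw [← sq_abs, abs_truncMap hr0.le, min_eq_right h]
    refine ⟨|x| / r, (one_le_div hr0).mpr h, ?_, ?_⟩
    · rw [div_mul_eq_mul_div, abs_mul_truncMap_of_le_abs h, mul_div_cancel_left₀ _ hr0.ne']
    · have hinv : |x| / r ≤ |x| := div_le_self (abs_nonneg x) hr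
      have hxr : |x| / r * r ^ 2 ≤ x ^ 2 := by
        rw [← sq_abs x, show |x| / r * r ^ 2 = |x| * r by field_simp]
        nlinarith [abs_nonneg x]
      have hxb : |x| / r * truncMap r y ^ 2 ≤ x ^ 2 := by
        refine le_trans ?_ hxr
        gcongr ?_ * ?_
        exact sq_le_sq.mpr (by rwa [abs_of_pos hr0])
      rw [ha2]
      nlinarith [sq_nonneg (|x| - 1), sq_abs x, sq_nonneg y]


/-- Lemma 2.2: the truncation preserves the Khasminskii-type condition
(with constant `3K`). -/
theorem truncated_khasminskii
    (T p K : ℝ) (hT : 0 < T) (hp : 1 < p) (hK : 0 < K)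
    (f g : ℝ → ℝ → ℝ → ℝ)
    (hfg : ∀ t ∈ Set.Icc (0:ℝ) T, ∀ a b : ℝ,
      a * f t a b + (p - 1) * (g t a b) ^ 2 ≤ K * (1 + a ^ 2 + b ^ 2)) :
    ∀ r : ℝ, 1 ≤ r → ∀ t ∈ Set.Icc (0:ℝ) T, ∀ x y : ℝ,
      x * f t (truncMap r x) (truncMap r y)
        + (p - 1) * (g t (truncMap r x) (truncMap r y)) ^ 2
        ≤ 3 * K * (1 + x ^ 2 + y ^ 2) := by
  intro r hr t ht x y
  obtain ⟨c, hc, hx, hbound⟩ := exists_eq_mul_truncMap hr x y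
  have h := hfg t ht (truncMap r x) (truncMap r y)
  set a := truncMap r x
  set b := truncMap r y
  have hg : 0 ≤ (p - 1) * g t a b ^ 2 := mul_nonneg (by linarith) (sq_nonneg _)
  calc x * f t a b + (p - 1) * g t a b ^ 2
      = c * (a * f t a b) + (p - 1) * g t a b ^ 2 := by
        rw [← mul_assoc, ← hx]
    _ ≤ c * (a * f t a b) + c * ((p - 1) * g t a b ^ 2) := by
        linarith [le_mul_of_one_le_left hg hc]
    _ = c * (a * f t a b + (p - 1) * g t a b ^ 2) := by ring
    _ ≤ c * (K * (1 + a ^ 2 + b ^ 2)) := by gcongr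
    _ = K * (c * (1 + a ^ 2 + b ^ 2)) := by ring
    _ ≤ K * (3 * (1 + x ^ 2 + y ^ 2)) := mul_le_mul_of_nonneg_left hbound hK.le
    _ = 3 * K * (1 + x ^ 2 + y ^ 2) := by ring
end

section
/- Let f(t,x,y) = (1/8)|y|^{5/4} − 5x³ + 2ζ_t·x with ζ_t = (t(1−t))^{3/4}. Then for all t ∈ [0,1] and all x, x̄, y, ȳ ∈ ℝ, (x − x̄)·(f(t,x,y) − f(t,x̄,ȳ)) ≤ 3(x − x̄)² + (25/64)(y − ȳ)² − (5/2)(x − x̄)²(x² + x̄²) + (25/128)(y − ȳ)²(y² + ȳ²). -/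
noncomputable def zeta (t : ℝ) : ℝ := (t * (1 - t)) ^ ((3:ℝ)/4)

noncomputable def exDrift (t x y : ℝ) : ℝ :=
  (1/8) * |y| ^ ((5:ℝ)/4) - 5 * x ^ 3 + 2 * zeta t * x

theorem sq_pow_five_sub_le {u v : ℝ} (hu : 0 ≤ u) (hv : 0 ≤ v) :
    (u ^ 5 - v ^ 5) ^ 2 ≤ (u + v) ^ 2 * (u ^ 4 - v ^ 4) ^ 2 := by
  have h : 0 ≤ u * v * (u - v) ^ 2 * (u ^ 2 + u * v + v ^ 2) *
      ((u + v) ^ 2 * (u ^ 2 + v ^ 2) +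
        (u ^ 4 + u ^ 3 * v + u ^ 2 * v ^ 2 + u * v ^ 3 + v ^ 4)) := by
    positivity
  linear_combination h

theorem sq_le_one_add_pow_eight (u : ℝ) : u ^ 2 ≤ 1 + u ^ 8 := by
  nlinarith [sq_nonneg (u ^ 4 - 1 / 2), sq_nonneg (u ^ 2 - 1 / 2)]

theorem zeta_le_one {t : ℝ} (ht : t ∈ Set.Icc (0 : ℝ) 1) : zeta t ≤ 1 := by
  obtain ⟨h0, h1⟩ := ht
  exact Real.rpow_le_one (mul_nonneg h0 (sub_nonneg.2 h1)) (by nlinarith) (by norm_num)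

theorem exists_fourth_root {a : ℝ} (ha : 0 ≤ a) :
    ∃ u : ℝ, 0 ≤ u ∧ u ^ 4 = a ∧ u ^ 5 = a ^ ((5 : ℝ) / 4) := by
  refine ⟨a ^ ((1 : ℝ) / 4), Real.rpow_nonneg ha _, ?_, ?_⟩ <;>
    rw [← Real.rpow_natCast, ← Real.rpow_mul ha] <;> norm_num

theorem sq_abs_rpow_five_fourths_sub_le (y z : ℝ) :
    (|y| ^ ((5 : ℝ) / 4) - |z| ^ ((5 : ℝ) / 4)) ^ 2
      ≤ (4 + 2 * (y ^ 2 + z ^ 2)) * (y - z) ^ 2 := by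
  obtain ⟨u, hu, hu4, hu5⟩ := exists_fourth_root (abs_nonneg y)
  obtain ⟨v, hv, hv4, hv5⟩ := exists_fourth_root (abs_nonneg z)
  rw [← hu5, ← hv5]
  have hdiff : (u ^ 4 - v ^ 4) ^ 2 ≤ (y - z) ^ 2 := by
    rw [hu4, hv4]
    exact sq_le_sq.2 (abs_abs_sub_abs_le_abs_sub y z)
  have hu8 : u ^ 8 = y ^ 2 := by rw [← sq_abs y, ← hu4]; ring
  have hv8 : v ^ 8 = z ^ 2 := by rw [← sq_abs z, ← hv4]; ring
  have hsum : (u + v) ^ 2 ≤ 4 + 2 * (y ^ 2 + z ^ 2) := by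
    linarith [sq_le_one_add_pow_eight u, sq_le_one_add_pow_eight v, add_sq_le (a := u) (b := v)]
  exact (sq_pow_five_sub_le hu hv).trans (by gcongr)

/-- Drift estimate for the example SDDE (Section 4). -/
theorem example_drift_estimate :
    ∀ t ∈ Set.Icc (0:ℝ) 1, ∀ x xb y yb : ℝ,
      (x - xb) * (exDrift t x y - exDrift t xb yb)
        ≤ 3 * (x - xb) ^ 2 + (25/64) * (y - yb) ^ 2
          - (5/2) * (x - xb) ^ 2 * (x ^ 2 + xb ^ 2)
          + (25/128) * (y - yb) ^ 2 * (y ^ 2 + yb ^ 2) := by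
  intro t ht x xb y yb
  have hz : zeta t * (x - xb) ^ 2 ≤ (x - xb) ^ 2 :=
    mul_le_of_le_one_left (sq_nonneg _) (zeta_le_one ht)
  have hD := sq_abs_rpow_five_fourths_sub_le y yb
  have hcube : 0 ≤ (x - xb) ^ 2 * (x + xb) ^ 2 := by positivity
  have hy : 0 ≤ (y - yb) ^ 2 * (y ^ 2 + yb ^ 2) := by positivity
  unfold exDrift
  generalize |y| ^ ((5 : ℝ) / 4) = a at *
  generalize |yb| ^ ((5 : ℝ) / 4) = b at *
  linarith [sq_nonneg ((x - xb) - (a - b) / 16), sq_nonneg (y - yb)]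
end

section
/- Let g(t,x,y) = (1/2)|x|^{3/2} + ζ_t·y with ζ_t = (t(1−t))^{3/4}. Then for all t ∈ [0,1] and all x, x̄, y, ȳ ∈ ℝ, (g(t,x,y) − g(t,x̄,ȳ))² ≤ (9/2)(x − x̄)² + 2(y − ȳ)² + (9/4)(x − x̄)²(x² + x̄²). -/
noncomputable def exDiffusion (t x y : ℝ) : ℝ :=
  (1/2) * |x| ^ ((3:ℝ)/2) + zeta t * y

lemma zeta_sq_le_one {t : ℝ} (ht : t ∈ Set.Icc (0:ℝ) 1) : zeta t ^ 2 ≤ 1 := by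
  obtain ⟨h0, h1⟩ := ht
  have hnonneg : 0 ≤ t * (1 - t) := mul_nonneg h0 (by linarith)
  have hz : 0 ≤ zeta t := Real.rpow_nonneg hnonneg _
  have hz1 : zeta t ≤ 1 := Real.rpow_le_one hnonneg (by nlinarith) (by norm_num)
  exact pow_le_one₀ hz hz1

lemma rpow_three_halves_eq_sqrt_pow {a : ℝ} (ha : 0 ≤ a) :
    a ^ ((3:ℝ)/2) = √a ^ 3 := by
  rw [Real.sqrt_eq_rpow, ← Real.rpow_natCast, ← Real.rpow_mul ha]
  norm_num

lemma sq_cube_sub_cube_le {u v : ℝ} (hu : 0 ≤ u) (hv : 0 ≤ v) :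
    (u ^ 3 - v ^ 3) ^ 2 ≤ (u ^ 2 - v ^ 2) ^ 2 * (9 + 9/2 * (u ^ 4 + v ^ 4)) := by
  have huv : 0 ≤ u * v := mul_nonneg hu hv
  have h1 : (u ^ 2 + u * v + v ^ 2) ^ 2 ≤ ((u + v) ^ 2) ^ 2 :=
    pow_le_pow_left₀ (by positivity) (by nlinarith) 2
  have h2 : (u + v) ^ 2 ≤ 9 + 9/2 * (u ^ 4 + v ^ 4) := by
    nlinarith [sq_nonneg (u - v), sq_nonneg (u ^ 2 - 1), sq_nonneg (v ^ 2 - 1)]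
  calc (u ^ 3 - v ^ 3) ^ 2
      = (u - v) ^ 2 * (u ^ 2 + u * v + v ^ 2) ^ 2 := by ring
    _ ≤ (u - v) ^ 2 * ((u + v) ^ 2) ^ 2 := by gcongr
    _ = (u ^ 2 - v ^ 2) ^ 2 * (u + v) ^ 2 := by ring
    _ ≤ _ := by gcongr

lemma sq_abs_rpow_three_halves_sub_le (x z : ℝ) :
    (|x| ^ ((3:ℝ)/2) - |z| ^ ((3:ℝ)/2)) ^ 2
      ≤ (x - z) ^ 2 * (9 + 9/2 * (x ^ 2 + z ^ 2)) := by
  have sqrt_pow_four (a : ℝ) : √|a| ^ 4 = a ^ 2 := by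
    rw [show √|a| ^ 4 = (√|a| ^ 2) ^ 2 by ring, Real.sq_sqrt (abs_nonneg a), sq_abs]
  have h := sq_cube_sub_cube_le (Real.sqrt_nonneg |x|) (Real.sqrt_nonneg |z|)
  rw [sqrt_pow_four, sqrt_pow_four, Real.sq_sqrt (abs_nonneg x),
    Real.sq_sqrt (abs_nonneg z)] at h
  rw [rpow_three_halves_eq_sqrt_pow (abs_nonneg x), rpow_three_halves_eq_sqrt_pow (abs_nonneg z)]
  refine h.trans (mul_le_mul_of_nonneg_right ?_ (by positivity))
  exact sq_le_sq.mpr (abs_abs_sub_abs_le_abs_sub x z)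

/-- Diffusion estimate for the example SDDE (Section 4, with q = 2). -/
theorem example_diffusion_estimate :
    ∀ t ∈ Set.Icc (0:ℝ) 1, ∀ x xb y yb : ℝ,
      (exDiffusion t x y - exDiffusion t xb yb) ^ 2
        ≤ (9/2) * (x - xb) ^ 2 + 2 * (y - yb) ^ 2
          + (9/4) * (x - xb) ^ 2 * (x ^ 2 + xb ^ 2) := by
  intro t ht x xb y yb
  have hz := mul_le_mul_of_nonneg_right (zeta_sq_le_one ht) (sq_nonneg (y - yb))
  have hx := sq_abs_rpow_three_halves_sub_le x xb
  unfold exDiffusion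
  set p := |x| ^ ((3:ℝ)/2)
  set q := |xb| ^ ((3:ℝ)/2)
  have hsum := add_sq_le (a := 1/2 * (p - q)) (b := zeta t * (y - yb))
  linear_combination hsum + 2 * hz + 1/2 * hx
end

section
/- Let f(t,x,y) = (1/8)|y|^{5/4} − 5x³ + 2ζ_t·x and g(t,x,y) = (1/2)|x|^{3/2} + ζ_t·y with ζ_t = (t(1−t))^{3/4}. Then for every constant K₁ > 0 there exist t ∈ [0,1] and a, ā, b, b̄ ∈ ℝ such that (a − ā)·(f(t,a,b) − f(t,ā,b̄)) + (g(t,a,b) − g(t,ā,b̄))² > K₁·((a − ā)² + (b − b̄)²). -/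
theorem zeta_zero : zeta 0 = 0 := by
  have h : ((3:ℝ)/4) ≠ 0 := by norm_num
  simp [zeta, Real.zero_rpow h]

theorem pow_four_rpow_five_fourths {n : ℝ} (hn : 0 ≤ n) :
    (n ^ 4) ^ ((5:ℝ)/4) = n ^ 5 := by
  rw [← Real.rpow_natCast n 4, ← Real.rpow_mul hn, ← Real.rpow_natCast n 5]
  norm_num

theorem pow_five_add_le_rpow_five_fourths {n : ℝ} (hn : 0 ≤ n) :
    n ^ 5 + n ≤ (n ^ 4 + 1) ^ ((5:ℝ)/4) := by
  have hpos : 0 < n ^ 4 + 1 := by positivity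
  have hroot : n ≤ (n ^ 4 + 1) ^ ((1:ℝ)/4) := by
    calc n = (n ^ 4) ^ ((1:ℝ)/4) := by
          rw [← Real.rpow_natCast n 4, ← Real.rpow_mul hn]
          norm_num
      _ ≤ (n ^ 4 + 1) ^ ((1:ℝ)/4) := by gcongr; linarith
  calc n ^ 5 + n = (n ^ 4 + 1) * n := by ring
    _ ≤ (n ^ 4 + 1) * (n ^ 4 + 1) ^ ((1:ℝ)/4) := by gcongr
    _ = (n ^ 4 + 1) ^ ((5:ℝ)/4) := by
      rw [← Real.rpow_one_add' hpos.le (by norm_num)]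
      norm_num

/-- Remark 1: no constant `K₁` makes the classical monotone condition hold
for the example SDDE. -/
theorem example_fails_classical_monotone :
    ∀ K₁ : ℝ, 0 < K₁ →
      ∃ t ∈ Set.Icc (0:ℝ) 1, ∃ a abar b bbar : ℝ,
        K₁ * ((a - abar) ^ 2 + (b - bbar) ^ 2)
          < (a - abar) * (exDrift t a b - exDrift t abar bbar)
            + (exDiffusion t a b - exDiffusion t abar bbar) ^ 2 := by
  intro K hK
  have hn : 0 ≤ 16 * K + 100 := by linarith
  refine ⟨0, by simp, 1, 0, (16 * K + 100) ^ 4 + 1, (16 * K + 100) ^ 4, ?_⟩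
  have hgrowth := pow_five_add_le_rpow_five_fourths hn
  have hexp : ((3:ℝ)/2) ≠ 0 := by norm_num
  simp only [exDrift, exDiffusion, zeta_zero, abs_one, abs_zero, Real.one_rpow,
    Real.zero_rpow hexp, abs_of_nonneg (pow_nonneg hn 4),
    abs_of_nonneg (add_nonneg (pow_nonneg hn 4) zero_le_one),
    pow_four_rpow_five_fourths hn]
  linarith
end

section
/- Let f(t,x,y) = (1/8)|y|^{5/4} − 5x³ + 2ζ_t·x and g(t,x,y) = (1/2)|x|^{3/2} + ζ_t·y with ζ_t = (t(1−t))^{3/4}. Then for every real p > 2 there exists a constant K₂ > 0 such that for all t ∈ [0,1] and all a, b ∈ ℝ, a·f(t,a,b) + (p − 1)·g(t,a,b)² ≤ K₂(1 + a² + b²). -/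
theorem zeta_mem_Icc {t : ℝ} (ht : t ∈ Set.Icc (0:ℝ) 1) : zeta t ∈ Set.Icc (0:ℝ) 1 := by
  obtain ⟨h0, h1⟩ := ht
  have h : 0 ≤ t * (1 - t) := mul_nonneg h0 (by linarith)
  exact ⟨Real.rpow_nonneg h _, Real.rpow_le_one h (by nlinarith) (by norm_num)⟩

theorem mul_abs_rpow_five_quarters_le (a b : ℝ) :
    a * |b| ^ ((5:ℝ)/4) ≤ a ^ 4 + b ^ 2 + 1 := by
  set v := |b| ^ ((1:ℝ)/4) with hv
  have h5 : |b| ^ ((5:ℝ)/4) = v ^ 5 := by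
    rw [hv, ← Real.rpow_mul_natCast (abs_nonneg b)]
    norm_num
  have h8 : b ^ 2 = v ^ 8 := by
    rw [hv, ← Real.rpow_mul_natCast (abs_nonneg b)]
    norm_num
  rw [h5, h8]
  nlinarith [sq_nonneg (a * v - v ^ 4), sq_nonneg (a ^ 2 - v ^ 2), sq_nonneg (v ^ 4 - 1),
    sq_nonneg (a ^ 2), sq_nonneg (v ^ 4)]

theorem abs_rpow_three_halves_sq (a : ℝ) : (|a| ^ ((3:ℝ)/2)) ^ 2 = |a| ^ 3 := by
  rw [← Real.rpow_mul_natCast (abs_nonneg a), ← Real.rpow_natCast]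
  norm_num

theorem exDiffusion_sq_le {t : ℝ} (ht : t ∈ Set.Icc (0:ℝ) 1) (a b : ℝ) :
    exDiffusion t a b ^ 2 ≤ |a| ^ 3 / 2 + 2 * b ^ 2 := by
  obtain ⟨h0, h1⟩ := zeta_mem_Icc ht
  have hz : (zeta t * b) ^ 2 ≤ b ^ 2 := by
    rw [mul_pow]
    exact mul_le_of_le_one_left (sq_nonneg b) (pow_le_one₀ h0 h1)
  rw [← abs_rpow_three_halves_sq, exDiffusion]
  nlinarith [sq_nonneg ((1/2) * |a| ^ ((3:ℝ)/2) - zeta t * b)]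

theorem mul_exDrift_le {t : ℝ} (ht : t ∈ Set.Icc (0:ℝ) 1) (a b : ℝ) :
    a * exDrift t a b ≤ -4 * a ^ 4 + 2 * a ^ 2 + b ^ 2 + 1 := by
  have hz : zeta t * a ^ 2 ≤ a ^ 2 := mul_le_of_le_one_left (sq_nonneg a) (zeta_mem_Icc ht).2
  rw [exDrift]
  nlinarith [mul_abs_rpow_five_quarters_le a b, sq_nonneg (a ^ 2), sq_nonneg b]

/-- Verification of Assumption 3.3 (Khasminskii-type condition) for the
example SDDE, for every moment order `p > 2`. -/
theorem example_khasminskii :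
    ∀ p : ℝ, 2 < p → ∃ K₂ : ℝ, 0 < K₂ ∧
      ∀ t ∈ Set.Icc (0:ℝ) 1, ∀ a b : ℝ,
        a * exDrift t a b + (p - 1) * (exDiffusion t a b) ^ 2
          ≤ K₂ * (1 + a ^ 2 + b ^ 2) := by
  intro p hp
  refine ⟨2 + p ^ 2, by positivity, fun t ht a b => ?_⟩
  have hg := mul_le_mul_of_nonneg_left (exDiffusion_sq_le ht a b) (by linarith : 0 ≤ p - 1)
  have hc : (p - 1) * |a| ^ 3 ≤ a ^ 4 + (p - 1) ^ 2 * a ^ 2 := by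
    rw [← sq_abs a, ← Even.pow_abs (by decide : Even 4) a]
    nlinarith [sq_nonneg (|a| ^ 2 - (p - 1) * |a|), sq_nonneg (|a| ^ 2),
      sq_nonneg ((p - 1) * |a|)]
  have hb : (1 + 2 * (p - 1)) * b ^ 2 ≤ (2 + p ^ 2) * b ^ 2 :=
    mul_le_mul_of_nonneg_right (by nlinarith) (sq_nonneg b)
  have ha : (2 + (p - 1) ^ 2) * a ^ 2 ≤ (2 + p ^ 2) * a ^ 2 :=
    mul_le_mul_of_nonneg_right (by nlinarith) (sq_nonneg a)
  nlinarith [mul_exDrift_le ht a b, sq_nonneg (a ^ 2), sq_nonneg p,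
    mul_nonneg (sq_nonneg (p - 1)) (sq_nonneg a)]
end

section
/- For all real numbers x and x̄, ( |x|^{3/2} − |x̄|^{3/2} )² ≤ 9·(x − x̄)² + (9/2)·(x − x̄)²·(x² + x̄²). -/
theorem sq_sub_rpow_three_halves_le {u v : ℝ} (hu : 0 ≤ u) (hv : 0 ≤ v) :
    (u ^ ((3:ℝ)/2) - v ^ ((3:ℝ)/2)) ^ 2 ≤ 2 * (u - v) ^ 2 * (u + v) := by
  have rpow_eq {t : ℝ} (ht : 0 ≤ t) : t ^ ((3:ℝ)/2) = √t ^ 3 := by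
    rw [Real.sqrt_eq_rpow, ← Real.rpow_natCast, ← Real.rpow_mul ht]
    norm_num
  rw [rpow_eq hu, rpow_eq hv]
  have ha := Real.sqrt_nonneg u
  have hb := Real.sqrt_nonneg v
  have hua := Real.sq_sqrt hu
  have hvb := Real.sq_sqrt hv
  generalize √u = a at *
  generalize √v = b at *
  subst hua hvb
  calc (a ^ 3 - b ^ 3) ^ 2 = (a - b) ^ 2 * (a ^ 2 + a * b + b ^ 2) ^ 2 := by ring
    _ ≤ (a - b) ^ 2 * ((a + b) ^ 2) ^ 2 := by
      gcongr
      nlinarith [mul_nonneg ha hb]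
    _ = (a ^ 2 - b ^ 2) ^ 2 * (a + b) ^ 2 := by ring
    _ ≤ (a ^ 2 - b ^ 2) ^ 2 * (2 * (a ^ 2 + b ^ 2)) := by
      gcongr
      exact add_sq_le
    _ = 2 * (a ^ 2 - b ^ 2) ^ 2 * (a ^ 2 + b ^ 2) := by ring

/-- Estimate for the superlinear part `|x|^{3/2}` of the example diffusion
coefficient (Section 4). -/
theorem abs_rpow_three_halves_diff_sq (x xb : ℝ) :
    (|x| ^ ((3:ℝ)/2) - |xb| ^ ((3:ℝ)/2)) ^ 2
      ≤ 9 * (x - xb) ^ 2 + (9/2) * (x - xb) ^ 2 * (x ^ 2 + xb ^ 2) := by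
  have hsub : (|x| - |xb|) ^ 2 ≤ (x - xb) ^ 2 := sq_le_sq.mpr (abs_abs_sub_abs_le x xb)
  have hadd : 2 * (|x| + |xb|) ≤ 9 + 9 / 2 * (x ^ 2 + xb ^ 2) := by
    rw [← sq_abs x, ← sq_abs xb]
    nlinarith [sq_nonneg (|x| - 1), sq_nonneg (|xb| - 1), sq_nonneg |x|, sq_nonneg |xb|]
  calc (|x| ^ ((3:ℝ)/2) - |xb| ^ ((3:ℝ)/2)) ^ 2
      ≤ 2 * (|x| - |xb|) ^ 2 * (|x| + |xb|) :=
        sq_sub_rpow_three_halves_le (abs_nonneg x) (abs_nonneg xb)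
    _ = (|x| - |xb|) ^ 2 * (2 * (|x| + |xb|)) := by ring
    _ ≤ (x - xb) ^ 2 * (9 + 9 / 2 * (x ^ 2 + xb ^ 2)) := by gcongr
    _ = 9 * (x - xb) ^ 2 + (9/2) * (x - xb) ^ 2 * (x ^ 2 + xb ^ 2) := by ring
end

section
/- Let f(t,x,y) = (1/8)|y|^{5/4} − 5x³ + 2ζ_t·x and g(t,x,y) = (1/2)|x|^{3/2} + ζ_t·y with ζ_t = (t(1−t))^{3/4}. Then there exists a constant K̄ > 0 such that for all t ∈ [0,1] and all a, b, ā, b̄ ∈ ℝ, max(|f(t,a,b) − f(t,ā,b̄)|, |g(t,a,b) − g(t,ā,b̄)|) ≤ K̄·(1 + a² + b² + ā² + b̄²)·(|a − ā| + |b − b̄|). -/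
theorem rpow_sub_rpow_le_mul_sub {p u v : ℝ} (hp : 1 ≤ p) (hu : 0 ≤ u) (hv : 0 < v) :
    v ^ p - u ^ p ≤ p * v ^ (p - 1) * (v - u) := by
  have hb := one_add_mul_self_le_rpow_one_add (s := u / v - 1) (by
    have := div_nonneg hu hv.le
    linarith) hp
  rw [add_sub_cancel, Real.div_rpow hu hv.le, le_div_iff₀ (Real.rpow_pos_of_pos hv p)] at hb
  have hvp : v ^ p = v ^ (p - 1) * v := by
    rw [← Real.rpow_add_one hv.ne', sub_add_cancel]
  have hmul : (1 + p * (u / v - 1)) * v ^ p = v ^ p - p * v ^ (p - 1) * (v - u) := by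
    rw [hvp]
    field_simp
    ring
  linarith

theorem rpow_le_one_add_sq {q v : ℝ} (hq : 0 ≤ q) (hq' : q ≤ 2) (hv : 0 ≤ v) :
    v ^ q ≤ 1 + v ^ 2 := by
  rcases le_total v 1 with h | h
  · have := Real.rpow_le_one hv h hq
    nlinarith [sq_nonneg v]
  · have := Real.rpow_le_rpow_of_exponent_le h hq'
    rw [Real.rpow_two] at this
    linarith

theorem abs_abs_rpow_sub_abs_rpow_le {p : ℝ} (hp : 1 ≤ p) (hp' : p ≤ 3) (x y : ℝ) :
    |(|x| ^ p - |y| ^ p)| ≤ p * (1 + x ^ 2 + y ^ 2) * |x - y| := by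
  wlog hxy : |y| ≤ |x| generalizing x y
  · have := this y x (le_of_not_ge hxy)
    rw [abs_sub_comm, abs_sub_comm x y]
    linarith
  have hp0 : 0 ≤ p := by linarith
  rw [abs_of_nonneg (sub_nonneg.2 (Real.rpow_le_rpow (abs_nonneg y) hxy hp0))]
  rcases (abs_nonneg x).eq_or_lt with h0 | hx
  · have hy : |y| = |x| := le_antisymm hxy (h0 ▸ abs_nonneg y)
    rw [hy, sub_self]
    positivity
  · have hq := rpow_le_one_add_sq (q := p - 1) (by linarith) (by linarith) hx.le
    rw [sq_abs] at hq
    calc |x| ^ p - |y| ^ p ≤ p * |x| ^ (p - 1) * (|x| - |y|) :=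
          rpow_sub_rpow_le_mul_sub hp (abs_nonneg y) hx
      _ ≤ p * (1 + x ^ 2 + y ^ 2) * |x - y| := by
          gcongr
          · linarith [sq_nonneg y]
          · exact abs_sub_abs_le_abs_sub x y

theorem abs_cube_sub_cube_le (x y : ℝ) :
    |x ^ 3 - y ^ 3| ≤ 3 / 2 * (1 + x ^ 2 + y ^ 2) * |x - y| := by
  rw [show x ^ 3 - y ^ 3 = (x ^ 2 + x * y + y ^ 2) * (x - y) by ring, abs_mul]
  gcongr
  rw [abs_le]
  constructor <;> nlinarith [sq_nonneg (x - y), sq_nonneg (x + y)]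

theorem zeta_nonneg {t : ℝ} (ht : t ∈ Set.Icc (0 : ℝ) 1) : 0 ≤ zeta t :=
  Real.rpow_nonneg (mul_nonneg ht.1 (sub_nonneg.2 ht.2)) _

/-- Verification of Assumption 3.1 (polynomial local Lipschitz condition,
with β = 2) for the example SDDE. -/
theorem example_poly_local_lipschitz :
    ∃ Kbar : ℝ, 0 < Kbar ∧
      ∀ t ∈ Set.Icc (0:ℝ) 1, ∀ a b abar bbar : ℝ,
        max |exDrift t a b - exDrift t abar bbar|
            |exDiffusion t a b - exDiffusion t abar bbar|
          ≤ Kbar * (1 + a ^ 2 + b ^ 2 + abar ^ 2 + bbar ^ 2)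
              * (|a - abar| + |b - bbar|) := by
  refine ⟨10, by norm_num, fun t ht a b c d => ?_⟩
  have hz := zeta_nonneg ht
  have hz1 := zeta_le_one ht
  set M := 1 + a ^ 2 + b ^ 2 + c ^ 2 + d ^ 2 with hM
  have hM1 : 1 ≤ M := by nlinarith [sq_nonneg a, sq_nonneg b, sq_nonneg c, sq_nonneg d]
  have hac : 1 + a ^ 2 + c ^ 2 ≤ M := by nlinarith [sq_nonneg b, sq_nonneg d]
  have hbd : 1 + b ^ 2 + d ^ 2 ≤ M := by nlinarith [sq_nonneg a, sq_nonneg c]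
  have hlin (x : ℝ) : |zeta t * x| ≤ M * |x| := by
    rw [abs_mul, abs_of_nonneg hz]
    gcongr
    linarith
  have hMac : 0 ≤ M * |a - c| := by positivity
  have hMbd : 0 ≤ M * |b - d| := by positivity
  have h_cube : |a ^ 3 - c ^ 3| ≤ 3 / 2 * M * |a - c| :=
    (abs_cube_sub_cube_le a c).trans (by gcongr)
  have h_drift : |(|b| ^ ((5 : ℝ) / 4) - |d| ^ ((5 : ℝ) / 4))| ≤ 5 / 4 * M * |b - d| :=
    (abs_abs_rpow_sub_abs_rpow_le (by norm_num) (by norm_num) b d).trans (by gcongr)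
  have h_diff : |(|a| ^ ((3 : ℝ) / 2) - |c| ^ ((3 : ℝ) / 2))| ≤ 3 / 2 * M * |a - c| :=
    (abs_abs_rpow_sub_abs_rpow_le (by norm_num) (by norm_num) a c).trans (by gcongr)
  have h_zeta_ac := hlin (a - c)
  have h_zeta_bd := hlin (b - d)
  rw [abs_le] at h_cube h_drift h_diff h_zeta_ac h_zeta_bd
  unfold exDrift exDiffusion
  refine max_le ?_ ?_ <;> rw [abs_le] <;> constructor <;> linarith
end

section
/- Let f(t,x,y) = (1/8)|y|^{5/4} − 5x³ + 2ζ_t·x and g(t,x,y) = (1/2)|x|^{3/2} + ζ_t·y with ζ_t = (t(1−t))^{3/4}. Then for all t₁, t₂ ∈ [0,1] and all a, b ∈ ℝ, max(|f(t₁,a,b) − f(t₂,a,b)|, |g(t₁,a,b) − g(t₂,a,b)|) ≤ 2·(1 + |a|³ + |b|³)·|t₁ − t₂|^{3/4}. -/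
/-- Subadditivity of `x ↦ x ^ p` for `0 ≤ p ≤ 1`, as a Hölder estimate. -/
theorem Real.abs_rpow_sub_rpow_le {p u v : ℝ} (hu : 0 ≤ u) (hv : 0 ≤ v) (hp : 0 ≤ p)
    (hp1 : p ≤ 1) : |u ^ p - v ^ p| ≤ |u - v| ^ p := by
  wlog h : v ≤ u generalizing u v
  · rw [abs_sub_comm, abs_sub_comm u]
    exact this hv hu (le_of_not_ge h)
  have hsub : 0 ≤ u - v := sub_nonneg.2 h
  rw [abs_of_nonneg hsub, abs_of_nonneg (sub_nonneg.2 (Real.rpow_le_rpow hv h hp))]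
  have key := Real.rpow_add_le_add_rpow hsub hv hp hp1
  rw [sub_add_cancel] at key
  linarith

theorem abs_zeta_sub_zeta_le {s t : ℝ} (hs : s ∈ Set.Icc (0:ℝ) 1) (ht : t ∈ Set.Icc (0:ℝ) 1) :
    |zeta s - zeta t| ≤ |s - t| ^ ((3:ℝ)/4) := by
  obtain ⟨hs0, hs1⟩ := hs
  obtain ⟨ht0, ht1⟩ := ht
  refine (Real.abs_rpow_sub_rpow_le (mul_nonneg hs0 (sub_nonneg.2 hs1))
    (mul_nonneg ht0 (sub_nonneg.2 ht1)) (by norm_num) (by norm_num)).trans ?_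
  refine Real.rpow_le_rpow (abs_nonneg _) ?_ (by norm_num)
  rw [show s * (1 - s) - t * (1 - t) = (s - t) * (1 - s - t) by ring, abs_mul]
  exact mul_le_of_le_one_right (abs_nonneg _) (abs_le.2 ⟨by linarith, by linarith⟩)

theorem le_one_add_pow_three {x : ℝ} (hx : 0 ≤ x) : x ≤ 1 + x ^ 3 := by
  rcases le_total x 1 with h | h
  · linarith [pow_nonneg hx 3]
  · linarith [le_self_pow₀ h (three_ne_zero)]

/-- Verification of Assumption 3.4 (Hölder continuity in time, with
σ = 3/4 and β + 1 = 3) for the example SDDE. -/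
theorem example_time_holder :
    ∀ t₁ ∈ Set.Icc (0:ℝ) 1, ∀ t₂ ∈ Set.Icc (0:ℝ) 1, ∀ a b : ℝ,
      max |exDrift t₁ a b - exDrift t₂ a b|
          |exDiffusion t₁ a b - exDiffusion t₂ a b|
        ≤ 2 * (1 + |a| ^ 3 + |b| ^ 3) * |t₁ - t₂| ^ ((3:ℝ)/4) := by
  intro t₁ ht₁ t₂ ht₂ a b
  have hζ := abs_zeta_sub_zeta_le ht₁ ht₂
  have ha := le_one_add_pow_three (abs_nonneg a)
  have hb := le_one_add_pow_three (abs_nonneg b)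
  have ha3 : 0 ≤ |a| ^ 3 := by positivity
  have hb3 : 0 ≤ |b| ^ 3 := by positivity
  refine max_le ?_ ?_
  · have h : exDrift t₁ a b - exDrift t₂ a b = 2 * a * (zeta t₁ - zeta t₂) := by
      unfold exDrift; ring
    rw [h, abs_mul, abs_mul, abs_two]
    gcongr
    linarith
  · have h : exDiffusion t₁ a b - exDiffusion t₂ a b = b * (zeta t₁ - zeta t₂) := by
      unfold exDiffusion; ring
    rw [h, abs_mul]
    gcongr
    linarith
end
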